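/- arXiv:2604.10365 — 5 statements merged into one kernel-verified Lean document; each statement's English description precedes it below -/
import Mathlib

section
/- Let (a_{i,j})_{i\ge 0, j\in\mathbb{Z}} be an r-periodic infinite frieze of positive integers. Then the value of a_{r,j} - a_{r-2,j+1} is the same for all choices of j \in \mathbb{Z}. -/
/-- The unimodularity relation extends to row `0` thanks to the convention on row `-1`. -/
theorem frieze_unimodular_of_nonneg (a : ℤ → ℤ → ℤ)
    (h0 : ∀ j : ℤ, a 0 j = 1) (hneg : ∀ j : ℤ, a (-1) j = 0)
    (huni : ∀ i : ℤ, 1 ≤ i → ∀ j : ℤ,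
      a i j * a i (j + 1) - a (i - 1) (j + 1) * a (i + 1) j = 1)
    (i : ℤ) (hi : 0 ≤ i) (j : ℤ) :
    a i j * a i (j + 1) - a (i - 1) (j + 1) * a (i + 1) j = 1 := by
  rcases hi.eq_or_lt with rfl | hi
  · simp [h0, hneg]
  · exact huni i hi j

/-- Expansion of a frieze entry along its last quiddity entry. -/
theorem frieze_expand_last (a : ℤ → ℤ → ℤ)
    (h0 : ∀ j : ℤ, a 0 j = 1) (hneg : ∀ j : ℤ, a (-1) j = 0)
    (hne : ∀ i : ℤ, 0 ≤ i → ∀ j : ℤ, a i j ≠ 0)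
    (huni : ∀ i : ℤ, 1 ≤ i → ∀ j : ℤ,
      a i j * a i (j + 1) - a (i - 1) (j + 1) * a (i + 1) j = 1)
    (i : ℤ) (hi : 0 ≤ i) (j : ℤ) :
    a (i + 1) j = a i j * a 1 (j + i) - a (i - 1) j := by
  induction i, hi using Int.leInduction generalizing j with
  | base => simp [h0, hneg]
  | succ i hi ih =>
    have h1 := huni (i + 1) (by lia) j
    have h2 := frieze_unimodular_of_nonneg a h0 hneg huni i hi j
    have h3 := ih (j + 1)
    rw [show j + 1 + i = j + (i + 1) by ring] at h3
    rw [add_sub_cancel_right] at h1 ⊢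
    apply mul_left_cancel₀ (hne i hi (j + 1))
    linear_combination h2 - h1 + a (i + 1) j * h3

/-- Expansion of a frieze entry along its first quiddity entry. -/
theorem frieze_expand_first (a : ℤ → ℤ → ℤ)
    (h0 : ∀ j : ℤ, a 0 j = 1) (hneg : ∀ j : ℤ, a (-1) j = 0)
    (hne : ∀ i : ℤ, 0 ≤ i → ∀ j : ℤ, a i j ≠ 0)
    (huni : ∀ i : ℤ, 1 ≤ i → ∀ j : ℤ,
      a i j * a i (j + 1) - a (i - 1) (j + 1) * a (i + 1) j = 1)
    (i : ℤ) (hi : 0 ≤ i) (j : ℤ) :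
    a (i + 1) j = a 1 j * a i (j + 1) - a (i - 1) (j + 2) := by
  induction i, hi using Int.leInduction generalizing j with
  | base => simp [h0, hneg]
  | succ i hi ih =>
    have h1 := huni (i + 1) (by lia) j
    have h2 := frieze_unimodular_of_nonneg a h0 hneg huni i hi (j + 1)
    have h3 := ih j
    rw [show j + 1 + 1 = j + 2 by ring] at h2
    rw [add_sub_cancel_right] at h1 ⊢
    apply mul_left_cancel₀ (hne i hi (j + 1))
    linear_combination h2 - h1 + a (i + 1) (j + 1) * h3

/-- Let `(a i j)` (for `i ≥ 0`, `j ∈ ℤ`) be an `r`-periodic infinite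
frieze of positive integers (with the conventions `a 0 j = 1` and `a (-1) j = 0`).
Then the value of `a r j - a (r-2) (j+1)` is the same for all `j`. -/
theorem growth_coefficient_well_defined
    (r : ℤ) (hr : 1 ≤ r) (a : ℤ → ℤ → ℤ)
    (h0 : ∀ j : ℤ, a 0 j = 1)
    (hneg : ∀ j : ℤ, a (-1) j = 0)
    (hpos : ∀ i : ℤ, 0 ≤ i → ∀ j : ℤ, 0 < a i j)
    (huni : ∀ i : ℤ, 1 ≤ i → ∀ j : ℤ,
      a i j * a i (j + 1) - a (i - 1) (j + 1) * a (i + 1) j = 1)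
    (hper : ∀ i j : ℤ, a i j = a i (j + r)) :
    ∀ j j' : ℤ, a r j - a (r - 2) (j + 1) = a r j' - a (r - 2) (j' + 1) := by
  have hne : ∀ i : ℤ, 0 ≤ i → ∀ j : ℤ, a i j ≠ 0 := fun i hi j => (hpos i hi j).ne'
  have hstep : Function.Periodic (fun j => a r j - a (r - 2) (j + 1)) 1 := by
    intro j
    have h1 := frieze_expand_first a h0 hneg hne huni (r - 1) (by lia) j
    have h2 := frieze_expand_last a h0 hneg hne huni (r - 1) (by lia) (j + 1)
    have h3 := hper 1 j
    rw [show r - 1 + 1 = r by ring, show r - 1 - 1 = r - 2 by ring] at h1 h2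
    rw [show j + 1 + (r - 1) = j + r by ring, ← h3] at h2
    simp only [show j + 1 + 1 = j + 2 by ring]
    linear_combination h2 - h1
  intro j j'
  simpa using hstep.int_mul (j - j') j'
end

section
/- Let (a_{i,j}) be an r-periodic infinite frieze of positive integers, and define its growth coefficients by s_0 = 2 and s_k = a_{rk,j} - a_{rk-2,j+1} for k \ge 1 (a value independent of j). Then s_{k+2} = s_1·s_{k+1} - s_k for all k \ge 0; in particular s_1 determines all s_k for k \ge 2. -/
/-- The quiddity entries `a 1 j` generate the frieze through a linear recurrence. -/
theorem frieze_linear_recurrence (a : ℤ → ℤ → ℤ)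
    (h0 : ∀ j : ℤ, a 0 j = 1) (hneg : ∀ j : ℤ, a (-1) j = 0)
    (hpos : ∀ i : ℤ, 0 ≤ i → ∀ j : ℤ, 0 < a i j)
    (huni : ∀ i : ℤ, 0 ≤ i → ∀ j : ℤ,
      a i j * a i (j + 1) - a (i - 1) (j + 1) * a (i + 1) j = 1)
    (i : ℤ) (hi : 0 ≤ i) : ∀ j : ℤ, a (i + 1) j = a i j * a 1 (j + i) - a (i - 1) j := by
  induction i, hi using Int.leInduction with
  | base => intro j; simp [h0, hneg]
  | succ i hi ih =>
    intro j
    have h1 := huni i hi j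
    have h2 := huni (i + 1) (by lia) j
    have h3 := ih (j + 1)
    rw [show j + 1 + i = j + (i + 1) by ring] at h3
    rw [show i + 1 - 1 = i by ring] at h2 ⊢
    refine mul_left_cancel₀ (hpos i hi (j + 1)).ne' ?_
    linear_combination h1 - h2 + a (i + 1) j * h3

/-- The monodromy matrix of a frieze over the window of `n` columns starting at `j`. -/
def friezeMatrix (a : ℤ → ℤ → ℤ) (n j : ℤ) : Matrix (Fin 2) (Fin 2) ℤ :=
  !![a n j, a (n - 1) j; -a (n - 1) (j + 1), -a (n - 2) (j + 1)]

theorem friezeMatrix_add (a : ℤ → ℤ → ℤ)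
    (h0 : ∀ j : ℤ, a 0 j = 1) (hneg : ∀ j : ℤ, a (-1) j = 0)
    (hrec : ∀ i : ℤ, 0 ≤ i → ∀ j : ℤ, a (i + 1) j = a i j * a 1 (j + i) - a (i - 1) j)
    (n j m : ℤ) (hn : 1 ≤ n) (hm : 1 ≤ m) :
    friezeMatrix a (n + m) j = friezeMatrix a n j * friezeMatrix a m (j + n) := by
  have step (n j : ℤ) (hn : 1 ≤ n) :
      friezeMatrix a (n + 1) j = friezeMatrix a n j * !![a 1 (j + n), 1; -1, 0] := by
    have h1 := hrec n (by lia) j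
    have h2 := hrec (n - 1) (by lia) (j + 1)
    rw [show n - 1 + 1 = n by ring, show j + 1 + (n - 1) = j + n by ring,
      show n - 1 - 1 = n - 2 by ring] at h2
    simp only [friezeMatrix, Matrix.mul_fin_two, show n + 1 - 1 = n by ring,
      show n + 1 - 2 = n - 1 by ring, h1, h2]
    congr! 3 <;> ring_nf
  induction m, hm using Int.leInduction with
  | base =>
    rw [step n j hn]
    simp [friezeMatrix, h0, hneg]
  | succ m hm ih =>
    rw [← add_assoc, step _ _ (by lia), ih, step m _ hm, mul_assoc, add_assoc j n m]

theorem Matrix.sq_eq_trace_smul_sub_one_of_det_eq_one {R : Type*} [CommRing R]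
    (A : Matrix (Fin 2) (Fin 2) R) (hA : A.det = 1) : A ^ 2 = A.trace • A - 1 := by
  rw [Matrix.det_fin_two] at hA
  rw [Matrix.trace_fin_two]
  ext i j
  fin_cases i <;> fin_cases j <;>
    simp only [sq, Matrix.mul_apply, Fin.sum_univ_two, Matrix.sub_apply, Matrix.smul_apply,
      smul_eq_mul, Matrix.one_apply, Fin.zero_eta, Fin.mk_one, Fin.isValue, if_true,
      zero_ne_one, one_ne_zero, if_false] <;>
    first
    | linear_combination -hA
    | ring

/-- Let `(a i j)` be an `r`-periodic infinite frieze of positive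
integers (conventions `a 0 j = 1`, `a (-1) j = 0`), and let `s` be its sequence of
growth coefficients: `s 0 = 2` and `s k = a (r*k) j - a (r*k - 2) (j+1)` for `k ≥ 1`
(independent of `j`).  Then `s (k+2) = s 1 * s (k+1) - s k` for all `k ≥ 0`. -/
theorem growth_coefficients_chebyshev_recurrence
    (r : ℤ) (hr : 1 ≤ r) (a : ℤ → ℤ → ℤ)
    (h0 : ∀ j : ℤ, a 0 j = 1)
    (hneg : ∀ j : ℤ, a (-1) j = 0)
    (hpos : ∀ i : ℤ, 0 ≤ i → ∀ j : ℤ, 0 < a i j)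
    (huni : ∀ i : ℤ, 1 ≤ i → ∀ j : ℤ,
      a i j * a i (j + 1) - a (i - 1) (j + 1) * a (i + 1) j = 1)
    (hper : ∀ i j : ℤ, a i j = a i (j + r))
    (s : ℕ → ℤ)
    (hs0 : s 0 = 2)
    (hs : ∀ k : ℕ, 1 ≤ k → ∀ j : ℤ,
      s k = a (r * k) j - a (r * k - 2) (j + 1)) :
    ∀ k : ℕ, s (k + 2) = s 1 * s (k + 1) - s k := by
  have huni' : ∀ i : ℤ, 0 ≤ i → ∀ j : ℤ,
      a i j * a i (j + 1) - a (i - 1) (j + 1) * a (i + 1) j = 1 := by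
    intro i hi j
    rcases hi.eq_or_lt with rfl | hi
    · simp [h0, hneg]
    · exact huni i hi j
  have hrec := frieze_linear_recurrence a h0 hneg hpos huni'
  set A := friezeMatrix a r 0 with hA
  have hdet : A.det = 1 := by
    have h := huni' (r - 1) (by lia) 0
    rw [show r - 1 - 1 = r - 2 by ring, show r - 1 + 1 = r by ring] at h
    rw [hA, friezeMatrix, Matrix.det_fin_two_of]
    linear_combination h
  have hshift (n : ℤ) : friezeMatrix a n r = friezeMatrix a n 0 := by
    simp only [friezeMatrix, add_comm r 1, ← hper]
    rw [hper n 0, hper (n - 1) 0, zero_add, zero_add]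
  have hpow (k : ℕ) : friezeMatrix a (r * (k + 1 : ℕ)) 0 = A ^ (k + 1) := by
    induction k with
    | zero => simp [hA]
    | succ k ih =>
      have hpos_rk : 1 ≤ r * ((k + 1 : ℕ) : ℤ) := by
        push_cast
        nlinarith
      rw [show r * ((k + 1 + 1 : ℕ) : ℤ) = r + r * ((k + 1 : ℕ) : ℤ) by push_cast; ring,
        friezeMatrix_add a h0 hneg hrec _ _ _ hr hpos_rk, zero_add, hshift, ih, ← hA,
        pow_succ' A (k + 1)]
  have htrace (k : ℕ) : s k = (A ^ k).trace := by
    cases k with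
    | zero => simp [hs0]
    | succ k =>
      rw [← hpow, hs (k + 1) (by lia) 0, friezeMatrix, Matrix.trace_fin_two_of]
      ring
  intro k
  rw [htrace, htrace, htrace, htrace, pow_one, pow_add,
    A.sq_eq_trace_smul_sub_one_of_det_eq_one hdet, mul_sub, mul_one, mul_smul_comm, ← pow_succ,
    Matrix.trace_sub, Matrix.trace_smul, smul_eq_mul]
end

section
/- Consider the universal r-periodic infinite frieze with values in \mathbb{Z}[z_1, \ldots, z_r]. For every k \ge 1, the value of a_{rk,j} - a_{rk-2,j+1} does not depend on j \in \mathbb{Z}; that is, the growth coefficients s_k = a_{rk,j} - a_{rk-2,j+1} are well-defined. -/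
open MvPolynomial

/-- The universal `r`-periodic infinite frieze, with values in the polynomial ring
`ℤ[z_0, …, z_{r-1}]` (variables indexed by `ZMod r`): `a i j = 0` for `i < 0`
(convention), `a 0 j = 1` (empty determinant), and for `i ≥ 1`, `a i j` is the
determinant of the `i × i` tridiagonal matrix with diagonal entries
`z_j, z_{j+1}, …, z_{j+i-1}` (variable indices taken modulo `r`) and all sub- and
super-diagonal entries equal to `1`. -/
noncomputable def univAP (r : ℕ) (i : ℤ) (j : ℤ) : MvPolynomial (ZMod r) ℤ :=
  if i < 0 then 0
  else
    (Matrix.of fun k l : Fin i.toNat =>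
      if (k : ℕ) = (l : ℕ) then X (((j + (k : ℕ) : ℤ) : ZMod r))
      else if (k : ℕ) + 1 = (l : ℕ) ∨ (l : ℕ) + 1 = (k : ℕ) then 1 else 0).det

/-- The `n × n` tridiagonal matrix with diagonal entries `f 0, …, f (n - 1)` and all sub- and
super-diagonal entries equal to `1`. -/
def unitTridiagonal {R : Type*} [CommRing R] (n : ℕ) (f : ℕ → R) : Matrix (Fin n) (Fin n) R :=
  Matrix.of fun k l : Fin n =>
    if (k : ℕ) = (l : ℕ) then f k
    else if (k : ℕ) + 1 = (l : ℕ) ∨ (l : ℕ) + 1 = (k : ℕ) then 1 else 0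

/-- Expansion of a tridiagonal determinant from the upper left corner. -/
theorem det_unitTridiagonal_add_two {R : Type*} [CommRing R] (n : ℕ) (f : ℕ → R) :
    (unitTridiagonal (n + 2) f).det =
      f 0 * (unitTridiagonal (n + 1) fun k => f (k + 1)).det -
        (unitTridiagonal n fun k => f (k + 2)).det := by
  have h₁ : (unitTridiagonal (n + 2) f).submatrix Fin.succ (Fin.succAbove 0) =
      unitTridiagonal (n + 1) fun k => f (k + 1) := by
    ext k l
    simp [unitTridiagonal]
  have h₂ : ((unitTridiagonal (n + 2) f).submatrix Fin.succ (Fin.succAbove 1)).det =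
      (unitTridiagonal n fun k => f (k + 2)).det := by
    rw [Matrix.det_succ_column_zero, Fin.sum_univ_succ, Finset.sum_eq_zero]
    · have h : ((unitTridiagonal (n + 2) f).submatrix Fin.succ (Fin.succAbove 1)).submatrix
          (Fin.succAbove 0) Fin.succ = unitTridiagonal n fun k => f (k + 2) := by
        ext k l
        have hl : (Fin.succAbove (1 : Fin (n + 2)) l.succ) = l.succ.succ :=
          Fin.succAbove_of_le_castSucc _ _ (by simp [Fin.le_def])
        simp [unitTridiagonal, hl]
      rw [h]
      simp [unitTridiagonal]
    · intro i _
      simp [unitTridiagonal]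
  rw [Matrix.det_succ_row_zero, Fin.sum_univ_succ, Fin.sum_univ_succ, Finset.sum_eq_zero, h₁]
  · have h₃ : Fin.succ (0 : Fin (n + 1)) = 1 := rfl
    rw [h₃, h₂]
    simp [unitTridiagonal]
    ring
  · intro i _
    simp [unitTridiagonal]

/-- Reversing the order of the diagonal does not change a tridiagonal determinant. -/
theorem det_unitTridiagonal_rev {R : Type*} [CommRing R] (n : ℕ) (f : ℕ → R) :
    (unitTridiagonal n fun k => f (n - 1 - k)).det = (unitTridiagonal n f).det := by
  rw [← Matrix.det_submatrix_equiv_self Fin.revPerm (unitTridiagonal n f)]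
  congr 1
  ext k l
  simp only [unitTridiagonal, Matrix.of_apply, Matrix.submatrix_apply, Fin.revPerm_apply,
    Fin.val_rev]
  have hk := k.isLt
  have hl := l.isLt
  have h : n - 1 - (k : ℕ) = n - (k + 1) := by omega
  rw [h]
  congr 1
  · apply propext; omega
  · congr 1
    apply propext; omega

/-- A tridiagonal determinant depends only on the diagonal entries occurring in it. -/
theorem det_unitTridiagonal_congr {R : Type*} [CommRing R] {n : ℕ} {f g : ℕ → R}
    (h : ∀ k < n, f k = g k) : (unitTridiagonal n f).det = (unitTridiagonal n g).det := by
  congr 1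
  ext k l
  simp [unitTridiagonal, h k k.isLt]

/-- Expansion of a tridiagonal determinant from the lower right corner. -/
theorem det_unitTridiagonal_add_two' {R : Type*} [CommRing R] (n : ℕ) (f : ℕ → R) :
    (unitTridiagonal (n + 2) f).det =
      f (n + 1) * (unitTridiagonal (n + 1) f).det - (unitTridiagonal n f).det := by
  rw [← det_unitTridiagonal_rev (n + 2), det_unitTridiagonal_add_two,
    ← det_unitTridiagonal_rev (n + 1) f, ← det_unitTridiagonal_rev n f]
  congr 1
  · congr 1
    apply det_unitTridiagonal_congr
    intro k hk
    congr 1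
    omega
  · apply det_unitTridiagonal_congr
    intro k hk
    congr 1
    omega

theorem univAP_natCast (r n : ℕ) (j : ℤ) :
    univAP r n j = (unitTridiagonal n fun k => (X ((j + k : ℤ) : ZMod r) :
      MvPolynomial (ZMod r) ℤ)).det := by
  simp [univAP, unitTridiagonal]

theorem univAP_add_two (r n : ℕ) (j : ℤ) :
    univAP r (n + 2 : ℕ) j =
      X (j : ZMod r) * univAP r (n + 1 : ℕ) (j + 1) - univAP r n (j + 2) := by
  simp only [univAP_natCast, det_unitTridiagonal_add_two n]
  congr! 6 <;> push_cast <;> ring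

theorem univAP_add_two' (r n : ℕ) (j : ℤ) :
    univAP r (n + 2 : ℕ) j =
      X ((j + (n + 1 : ℕ) : ℤ) : ZMod r) * univAP r (n + 1 : ℕ) j - univAP r n j := by
  simp only [univAP_natCast, det_unitTridiagonal_add_two' n]

theorem univAP_sub_univAP_add_one (r k : ℕ) (hr : 1 ≤ r) (hk : 1 ≤ k) (j : ℤ) :
    univAP r ((r : ℤ) * k) (j + 1) - univAP r ((r : ℤ) * k - 2) (j + 1 + 1) =
      univAP r ((r : ℤ) * k) j - univAP r ((r : ℤ) * k - 2) (j + 1) := by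
  obtain h | ⟨n, hn⟩ : r * k = 1 ∨ ∃ n, r * k = n + 2 := by
    have : 1 ≤ r * k := Nat.mul_pos hr hk
    rcases Nat.lt_or_ge (r * k) 2 with h | h
    · left; omega
    · right; exact ⟨r * k - 2, by omega⟩
  · obtain ⟨rfl, rfl⟩ := mul_eq_one.mp h
    simp [univAP, Subsingleton.elim _ (0 : ZMod 1)]
  · have h : (r : ℤ) * k = (n + 2 : ℕ) := by exact_mod_cast hn
    have h' : ((n + 2 : ℕ) : ℤ) - 2 = n := by push_cast; ring
    have hper : ((j + 1 + (n + 1 : ℕ) : ℤ) : ZMod r) = (j : ZMod r) := by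
      have : j + 1 + ((n + 1 : ℕ) : ℤ) = j + r * k := by rw [h]; push_cast; ring
      rw [this]
      simp
    rw [h, h', univAP_add_two r n j, univAP_add_two' r n (j + 1), hper,
      show j + 1 + 1 = j + 2 by ring]
    ring


/-- In the universal `r`-periodic infinite frieze, for every
`k ≥ 1`, the value of `a (r*k) j - a (r*k - 2) (j+1)` does not depend on `j`:
the growth coefficients are well-defined. -/
theorem universal_periodic_growth_coefficient_well_defined
    (r : ℕ) (hr : 1 ≤ r) :
    ∀ k : ℕ, 1 ≤ k → ∀ j j' : ℤ,
      univAP r ((r : ℤ) * k) j - univAP r ((r : ℤ) * k - 2) (j + 1) =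
      univAP r ((r : ℤ) * k) j' - univAP r ((r : ℤ) * k - 2) (j' + 1) := by
  intro k hk j j'
  have h₀ : ∀ j : ℤ, univAP r ((r : ℤ) * k) j - univAP r ((r : ℤ) * k - 2) (j + 1) =
      univAP r ((r : ℤ) * k) 0 - univAP r ((r : ℤ) * k - 2) (0 + 1) := by
    intro j
    induction j using Int.induction_on with
    | zero => rfl
    | succ i ih => rw [univAP_sub_univAP_add_one r k hr hk, ih]
    | pred i ih =>
      rw [← univAP_sub_univAP_add_one r k hr hk, sub_add_cancel, ih]
  rw [h₀ j, h₀ j']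
end

section
/- Let R be an integral domain and let (a_{i,j}) be an infinite frieze with values in R all of whose entries are non-zero. Then the frieze is determined by its quiddity row: for all i \ge 1 and j \in \mathbb{Z}, a_{i,j} equals the determinant of the i×i tridiagonal matrix whose diagonal entries are a_{1,j}, a_{1,j+1}, \ldots, a_{1,j+i-1} and whose sub- and super-diagonal entries are all equal to 1. Equivalently, the frieze is obtained from the universal infinite frieze by specializing each variable z_j to a_{1,j}. -/
/-- The continuant matrix of size `n`: tridiagonal with diagonal `z j, …, z (j + n - 1)` and ones
next to the diagonal. -/
def continuantMatrix {R : Type*} [CommRing R] (z : ℤ → R) (n : ℕ) (j : ℤ) :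
    Matrix (Fin n) (Fin n) R :=
  Matrix.of fun k l : Fin n =>
    if (k : ℕ) = (l : ℕ) then z (j + (k : ℕ))
    else if (k : ℕ) + 1 = (l : ℕ) ∨ (l : ℕ) + 1 = (k : ℕ) then 1 else 0

theorem continuantMatrix_submatrix_succ {R : Type*} [CommRing R] (z : ℤ → R) (n : ℕ) (j : ℤ) :
    (continuantMatrix z (n + 1) j).submatrix Fin.succ Fin.succ =
      continuantMatrix z n (j + 1) := by
  ext k l
  simp [continuantMatrix, add_assoc, add_comm (1 : ℤ)]

theorem det_continuantMatrix_add_two {R : Type*} [CommRing R] (z : ℤ → R) (n : ℕ) (j : ℤ) :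
    (continuantMatrix z (n + 2) j).det =
      z j * (continuantMatrix z (n + 1) (j + 1)).det - (continuantMatrix z n (j + 2)).det := by
  have hminor : ((continuantMatrix z (n + 2) j).submatrix Fin.succ
      (Fin.succAbove (Fin.succ 0))).det = (continuantMatrix z n (j + 2)).det := by
    have hsub : ((continuantMatrix z (n + 2) j).submatrix Fin.succ
        (Fin.succAbove (Fin.succ 0))).submatrix Fin.succ Fin.succ =
          continuantMatrix z n (j + 2) := by
      rw [show j + 2 = j + 1 + 1 by ring, ← continuantMatrix_submatrix_succ,
        ← continuantMatrix_submatrix_succ]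
      ext k l
      simp
    rw [Matrix.det_succ_column_zero, Fin.sum_univ_succ, Fin.succAbove_zero, hsub]
    simp [continuantMatrix]
  rw [Matrix.det_succ_row_zero, Fin.sum_univ_succ, Fin.sum_univ_succ, hminor,
    Fin.succAbove_zero, continuantMatrix_submatrix_succ]
  simp [continuantMatrix, sub_eq_add_neg]

/-- A frieze without zero entries satisfies the continuant recurrence. -/
theorem frieze_add_two {R : Type*} [CommRing R] [IsDomain R] (a : ℕ → ℤ → R)
    (h0 : ∀ j : ℤ, a 0 j = 1)
    (huni : ∀ i : ℕ, 1 ≤ i → ∀ j : ℤ,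
      a i j * a i (j + 1) - a (i - 1) (j + 1) * a (i + 1) j = 1)
    (hnz : ∀ (i : ℕ) (j : ℤ), a i j ≠ 0) (i : ℕ) (j : ℤ) :
    a (i + 2) j = a 1 j * a (i + 1) (j + 1) - a i (j + 2) := by
  induction i generalizing j with
  | zero =>
    have h := huni 1 le_rfl j
    simp only [Nat.sub_self, h0] at h ⊢
    linear_combination -h
  | succ i ih =>
    apply mul_left_cancel₀ (hnz (i + 1) (j + 1))
    have h₁ := huni (i + 1) (by lia) (j + 1)
    have h₂ := huni (i + 2) (by lia) j
    rw [show j + 1 + 1 = j + 2 by ring] at h₁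
    simp only [Nat.add_sub_cancel, show i + 2 - 1 = i + 1 from rfl] at h₁ h₂
    linear_combination h₁ - h₂ + a (i + 2) (j + 1) * ih j

theorem frieze_eq_det_continuantMatrix {R : Type*} [CommRing R] [IsDomain R] (a : ℕ → ℤ → R)
    (h0 : ∀ j : ℤ, a 0 j = 1)
    (huni : ∀ i : ℕ, 1 ≤ i → ∀ j : ℤ,
      a i j * a i (j + 1) - a (i - 1) (j + 1) * a (i + 1) j = 1)
    (hnz : ∀ (i : ℕ) (j : ℤ), a i j ≠ 0) (i : ℕ) (j : ℤ) :
    a i j = (continuantMatrix (a 1) i j).det := by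
  induction i using Nat.twoStepInduction generalizing j with
  | zero => simp [h0]
  | one => simp [continuantMatrix]
  | more i ih₀ ih₁ =>
    rw [det_continuantMatrix_add_two, ← ih₀, ← ih₁, frieze_add_two a h0 huni hnz]


/-- Let `R` be an integral domain and `(a i j)` an infinite frieze
with values in `R` all of whose entries are non-zero.  Then the frieze is determined
by its quiddity row: for all `i ≥ 1` and `j`, the entry `a i j` equals the
determinant of the `i × i` tridiagonal matrix with diagonal entries
`a 1 j, a 1 (j+1), …, a 1 (j+i-1)` and all sub- and super-diagonal entries equal
to `1` (i.e. the frieze is obtained from the universal infinite frieze by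
specializing each variable `z_j` to `a 1 j`). -/
theorem frieze_entries_as_continuants
    {R : Type*} [CommRing R] [IsDomain R]
    (a : ℕ → ℤ → R)
    (h0 : ∀ j : ℤ, a 0 j = 1)
    (huni : ∀ i : ℕ, 1 ≤ i → ∀ j : ℤ,
      a i j * a i (j + 1) - a (i - 1) (j + 1) * a (i + 1) j = 1)
    (hnz : ∀ (i : ℕ) (j : ℤ), a i j ≠ 0) :
    ∀ i : ℕ, 1 ≤ i → ∀ j : ℤ,
      a i j =
        (Matrix.of fun k l : Fin i =>
          if (k : ℕ) = (l : ℕ) then a 1 (j + (k : ℕ))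
          else if (k : ℕ) + 1 = (l : ℕ) ∨ (l : ℕ) + 1 = (k : ℕ) then 1 else 0).det := by
  intro i _ j
  exact frieze_eq_det_continuantMatrix a h0 huni hnz i j
end

section
/- Let R be an integral domain and let (a_{i,j}) be an r-periodic infinite frieze with values in R all of whose entries are non-zero. Then for every k \ge 1 the value of a_{rk,j} - a_{rk-2,j+1} does not depend on j \in \mathbb{Z}; that is, the growth coefficients s_k = a_{rk,j} - a_{rk-2,j+1} are well-defined elements of R. -/
/-- In a frieze over a domain with non-zero entries, each diagonal `a · j` satisfies the
linear recurrence with coefficients given by the first row. -/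
theorem frieze_right_recurrence {R : Type*} [CommRing R] [IsDomain R] (a : ℤ → ℤ → R)
    (h0 : ∀ j : ℤ, a 0 j = 1) (hneg : ∀ j : ℤ, a (-1) j = 0)
    (huni : ∀ i : ℤ, 1 ≤ i → ∀ j : ℤ,
      a i j * a i (j + 1) - a (i - 1) (j + 1) * a (i + 1) j = 1)
    (hnz : ∀ i : ℤ, 0 ≤ i → ∀ j : ℤ, a i j ≠ 0) (i : ℤ) (hi : 0 ≤ i) :
    ∀ j : ℤ, a (i + 1) j + a (i - 1) j = a 1 (j + i) * a i j := by
  induction i, hi using Int.leInduction with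
  | base => intro j; simp [h0, hneg]
  | succ i hi ih =>
    intro j
    apply mul_right_cancel₀ (hnz i hi (j + 1))
    have hprev : a i j * a i (j + 1) - a (i - 1) (j + 1) * a (i + 1) j = 1 := by
      rcases hi.eq_or_lt with rfl | hpos
      · simp [h0, hneg]
      · exact huni i hpos j
    have hnext := huni (i + 1) (by lia) j
    have hrec := ih (j + 1)
    rw [show j + 1 + i = j + (i + 1) by ring] at hrec
    simp only [add_sub_cancel_right] at hnext ⊢
    linear_combination hprev - hnext + a (i + 1) j * hrec

/-- The analogue of `frieze_right_recurrence` along the antidiagonals. -/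
theorem frieze_left_recurrence {R : Type*} [CommRing R] [IsDomain R] (a : ℤ → ℤ → R)
    (h0 : ∀ j : ℤ, a 0 j = 1) (hneg : ∀ j : ℤ, a (-1) j = 0)
    (huni : ∀ i : ℤ, 1 ≤ i → ∀ j : ℤ,
      a i j * a i (j + 1) - a (i - 1) (j + 1) * a (i + 1) j = 1)
    (hnz : ∀ i : ℤ, 0 ≤ i → ∀ j : ℤ, a i j ≠ 0) (i : ℤ) (hi : 0 ≤ i) :
    ∀ j : ℤ, a (i + 1) j + a (i - 1) (j + 2) = a 1 j * a i (j + 1) := by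
  induction i, hi using Int.leInduction with
  | base => intro j; simp [h0, hneg]
  | succ i hi ih =>
    intro j
    apply mul_right_cancel₀ (hnz i hi (j + 1))
    have hprev : a i (j + 1) * a i (j + 2) - a (i - 1) (j + 2) * a (i + 1) (j + 1) = 1 := by
      rcases hi.eq_or_lt with rfl | hpos
      · simp [h0, hneg]
      · simpa only [add_assoc, one_add_one_eq_two] using huni i hpos (j + 1)
    have hnext := huni (i + 1) (by lia) j
    have hrec := ih j
    simp only [add_sub_cancel_right] at hnext ⊢
    linear_combination hprev - hnext + a (i + 1) (j + 1) * hrec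

/-- Let `R` be an integral domain and `(a i j)` an `r`-periodic
infinite frieze with values in `R` all of whose entries are non-zero (with the
conventions `a 0 j = 1` and `a (-1) j = 0`).  Then for every `k ≥ 1` the value of
`a (r*k) j - a (r*k - 2) (j+1)` does not depend on `j`: the growth coefficients are
well-defined elements of `R`. -/
theorem domain_frieze_growth_coefficient_well_defined
    {R : Type*} [CommRing R] [IsDomain R]
    (r : ℤ) (hr : 1 ≤ r) (a : ℤ → ℤ → R)
    (h0 : ∀ j : ℤ, a 0 j = 1)
    (hneg : ∀ j : ℤ, a (-1) j = 0)
    (huni : ∀ i : ℤ, 1 ≤ i → ∀ j : ℤ,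
      a i j * a i (j + 1) - a (i - 1) (j + 1) * a (i + 1) j = 1)
    (hnz : ∀ i : ℤ, 0 ≤ i → ∀ j : ℤ, a i j ≠ 0)
    (hper : ∀ i j : ℤ, a i j = a i (j + r)) :
    ∀ k : ℤ, 1 ≤ k → ∀ j j' : ℤ,
      a (r * k) j - a (r * k - 2) (j + 1) = a (r * k) j' - a (r * k - 2) (j' + 1) := by
  intro k hk
  have hn : 0 ≤ r * k - 1 := by nlinarith
  have hperiod : Function.Periodic (a 1) (r * k) := by
    have hr_period : Function.Periodic (a 1) r := fun j => (hper 1 j).symm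
    simpa [mul_comm] using hr_period.int_mul k
  have hstep : Function.Periodic (fun j => a (r * k) j - a (r * k - 2) (j + 1)) 1 := by
    intro j
    have hright := frieze_right_recurrence a h0 hneg huni hnz (r * k - 1) hn (j + 1)
    have hleft := frieze_left_recurrence a h0 hneg huni hnz (r * k - 1) hn j
    rw [show j + 1 + (r * k - 1) = j + r * k by ring, hperiod j] at hright
    rw [sub_add_cancel, show r * k - 1 - 1 = r * k - 2 by ring] at hright hleft
    simp only [add_assoc, one_add_one_eq_two]
    linear_combination hright - hleft
  intro j j'
  simpa using (hstep.int_mul_eq j).trans (hstep.int_mul_eq j').symm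
end
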